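/- arXiv:math/0412046 — 9 statements merged into one kernel-verified Lean document; each statement's English description precedes it below -/
import Mathlib

section
/- Let n1, n2 ≥ 0 be integers and n = n1 + n2 + 1. Let g1, g2, h1, h2 ∈ ℂ, let a, v_1, …, v_{n1} ∈ ℂ^{n1+1} and b, w_1, …, w_{n2} ∈ ℂ^{n2+1}. Let M be the (n+1) × (n+1) complex matrix whose columns, written in block form ℂ^{n+1} = ℂ^{n1+1} × ℂ^{n2+1}, are in order: (g1·a, g2·b), (h1·a, h2·b), (g1·v_1, 0), …, (g1·v_{n1}, 0), (0, g2·w_1), …, (0, g2·w_{n2}). Then det M = (−1)^{n1} · g1^{n1} · g2^{n2} · (g1·h2 − h1·g2) · det[a, v_1, …, v_{n1}] · det[b, w_1, …, w_{n2}], where det[a, v_1, …, v_{n1}] is the determinant of the (n1+1) × (n1+1) matrix with the indicated columns, and similarly for the second factor. -/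
/-- The determinant of two diagonal blocks coupled only through their initial coordinates. -/
theorem det_fromBlocks_diagonal_cons {R : Type*} [CommRing R] (m n : ℕ) (x y z t c d : R) :
    (Matrix.fromBlocks
      (Matrix.diagonal (Fin.cons (α := fun _ => R) x fun _ : Fin m => c))
      (Matrix.single 0 0 z) (Matrix.single 0 0 y)
      (Matrix.diagonal (Fin.cons (α := fun _ => R) t fun _ : Fin n => d))).det
      = (x * t - z * y) * (c ^ m * d ^ n) := by
  have hf : Function.Bijective
      (Sum.elim ![Sum.inl 0, Sum.inr 0] (Sum.map Fin.succ Fin.succ) :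
        Fin 2 ⊕ (Fin m ⊕ Fin n) → Fin (m + 1) ⊕ Fin (n + 1)) := by
    constructor
    · rintro (i | i | i) (j | j | j) h <;> (try fin_cases i) <;> (try fin_cases j) <;>
        simp_all [Fin.succ_ne_zero, (Fin.succ_ne_zero _).symm]
    · rintro (i | i) <;> refine Fin.cases ?_ (fun k => ?_) i
      · exact ⟨.inl 0, rfl⟩
      · exact ⟨.inr (.inl k), rfl⟩
      · exact ⟨.inl 1, rfl⟩
      · exact ⟨.inr (.inr k), rfl⟩
  have hS : (Matrix.fromBlocks
      (Matrix.diagonal (Fin.cons (α := fun _ => R) x fun _ : Fin m => c))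
      (Matrix.single 0 0 z) (Matrix.single 0 0 y)
      (Matrix.diagonal (Fin.cons (α := fun _ => R) t fun _ : Fin n => d))).submatrix
        (Equiv.ofBijective _ hf) (Equiv.ofBijective _ hf)
      = Matrix.fromBlocks !![x, z; y, t] 0 0
        (Matrix.diagonal (Sum.elim (fun _ => c) (fun _ => d))) := by
    ext (i | i | i) (j | j | j) <;> (try fin_cases i) <;> (try fin_cases j) <;>
      simp [Matrix.diagonal_apply, Fin.succ_ne_zero,
        (Fin.succ_ne_zero _).symm]
  rw [← Matrix.det_submatrix_equiv_self (Equiv.ofBijective _ hf), hS,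
    Matrix.det_fromBlocks_zero₂₁, Matrix.det_fin_two_of, Matrix.det_diagonal]
  simp


/-- the block determinant identity computing the Legendrian angle of the
product immersion.  The `(n+1) × (n+1)` matrix `M` has rows indexed by
`ℂ^{n+1} = ℂ^{n1+1} × ℂ^{n2+1}` (via `finSumFinEquiv`) and columns, in order,
`(g1·a, g2·b)`, `(h1·a, h2·b)`, `(g1·v_k, 0)` for `k = 1,…,n1`, `(0, g2·w_k)` for
`k = 1,…,n2`. -/
theorem stmt_2 (n1 n2 n : ℕ) (hn : n = n1 + n2 + 1) (g1 g2 h1 h2 : ℂ)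
    (a : Fin (n1 + 1) → ℂ) (v : Fin n1 → Fin (n1 + 1) → ℂ)
    (b : Fin (n2 + 1) → ℂ) (w : Fin n2 → Fin (n2 + 1) → ℂ)
    (col : Fin ((n1 + 1) + (n2 + 1)) → (Fin (n1 + 1) → ℂ) × (Fin (n2 + 1) → ℂ))
    (hc0 : col ⟨0, by omega⟩ = (g1 • a, g2 • b))
    (hc1 : col ⟨1, by omega⟩ = (h1 • a, h2 • b))
    (hcv : ∀ k : Fin n1, col ⟨2 + (k : ℕ), by have := k.isLt; omega⟩ = (g1 • v k, 0))
    (hcw : ∀ k : Fin n2, col ⟨2 + n1 + (k : ℕ), by have := k.isLt; omega⟩ = (0, g2 • w k))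
    (M : Matrix (Fin ((n1 + 1) + (n2 + 1))) (Fin ((n1 + 1) + (n2 + 1))) ℂ)
    (hM : ∀ i j, M i j = Sum.elim ((col j).1) ((col j).2) (finSumFinEquiv.symm i)) :
    M.det = (-1 : ℂ) ^ n1 * g1 ^ n1 * g2 ^ n2 * (g1 * h2 - h1 * g2)
      * (Matrix.of fun i j => Fin.cons (α := fun _ => Fin (n1 + 1) → ℂ) a v j i).det
      * (Matrix.of fun i j => Fin.cons (α := fun _ => Fin (n2 + 1) → ℂ) b w j i).det := by
  set A : Matrix (Fin (n1 + 1)) (Fin (n1 + 1)) ℂ :=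
    Matrix.of fun i j => Fin.cons (α := fun _ => Fin (n1 + 1) → ℂ) a v j i with hA
  set B : Matrix (Fin (n2 + 1)) (Fin (n2 + 1)) ℂ :=
    Matrix.of fun i j => Fin.cons (α := fun _ => Fin (n2 + 1) → ℂ) b w j i with hB
  let p : Fin ((n1 + 1) + (n2 + 1)) := ⟨n1 + 1, by omega⟩
  have hp0 : p.cycleRange (Fin.castAdd (n2 + 1) 0) = ⟨1, by omega⟩ := by
    ext
    rw [Fin.coe_cycleRange_of_lt (by simp [Fin.lt_def, p])]
    simp
  have hpv (k : Fin n1) : p.cycleRange (Fin.castAdd (n2 + 1) k.succ)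
      = ⟨2 + (k : ℕ), by have := k.isLt; omega⟩ := by
    ext
    rw [Fin.coe_cycleRange_of_lt (by simp [Fin.lt_def, p])]
    simp
    omega
  have hp1 : p.cycleRange (Fin.natAdd (n1 + 1) 0) = ⟨0, by omega⟩ :=
    Fin.cycleRange_of_eq (by ext; simp [p])
  have hpw (k : Fin n2) : p.cycleRange (Fin.natAdd (n1 + 1) k.succ)
      = ⟨2 + n1 + (k : ℕ), by have := k.isLt; omega⟩ := by
    rw [Fin.cycleRange_of_gt (by simp [Fin.lt_def, p])]
    ext
    simp
    omega
  replace hc0 : col 0 = (g1 • a, g2 • b) := hc0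
  have hfac : (M.submatrix id p.cycleRange).submatrix finSumFinEquiv finSumFinEquiv
      = Matrix.fromBlocks A 0 0 B * Matrix.fromBlocks
        (Matrix.diagonal (Fin.cons (α := fun _ => ℂ) h1 fun _ : Fin n1 => g1))
        (Matrix.single 0 0 g1) (Matrix.single 0 0 h2)
        (Matrix.diagonal (Fin.cons (α := fun _ => ℂ) g2 fun _ : Fin n2 => g2)) := by
    rw [Matrix.fromBlocks_multiply]
    ext i (j | j) <;> refine Fin.cases ?_ (fun k => ?_) j <;> rcases i with i | i <;>
      simp [hM, hp0, hp1, hpv, hpw, hc0, hc1, hcv, hcw, hA, hB, mul_comm,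
        Matrix.mul_single_apply_of_ne]
  have hdet := congrArg Matrix.det hfac
  rw [Matrix.det_submatrix_equiv_self, Matrix.det_permute', Fin.sign_cycleRange,
    Matrix.det_mul, Matrix.det_fromBlocks_zero₂₁, det_fromBlocks_diagonal_cons] at hdet
  have hsq : ((-1 : ℂ) ^ n1) * (-1) ^ n1 = 1 := by rw [← mul_pow]; simp
  push_cast [p, pow_succ] at hdet
  linear_combination (-(-1 : ℂ) ^ n1) * hdet - M.det * hsq
end

section
/- Let m ≥ 3 be an integer and let z ∈ ℂ^m, regarded as a row vector. Suppose that Im(z · X · Y · z*) = 0 for all real skew-symmetric m × m matrices X and Y, where z* denotes the conjugate transpose of z. Then the vectors Re z and Im z of ℝ^m are linearly dependent over ℝ. -/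
open Matrix

/-- A matrix unit with distinct indices is a product of two skew-symmetric matrices, provided
there is a third index. -/
theorem Matrix.single_eq_mul_of_skew {n R : Type*} [Fintype n] [DecidableEq n] [Ring R]
    {p q k : n} (hpq : p ≠ q) (hpk : p ≠ k) (hqk : q ≠ k) :
    (single p k (1 : R) - single k p 1) * (single k q 1 - single q k 1) = single p q 1 := by
  simp [sub_mul, mul_sub, hpq, hpk, hqk.symm]

/-- Two real vectors with vanishing `2 × 2` minors are linearly dependent. -/
theorem exists_linear_relation_of_minors_eq_zero {ι : Type*} {a b : ι → ℝ}
    (h : ∀ i j, b i * a j = a i * b j) :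
    ∃ c d : ℝ, (c, d) ≠ (0, 0) ∧ ∀ i, c * a i + d * b i = 0 := by
  by_cases hab : ∃ i, (b i, -a i) ≠ (0, 0)
  · obtain ⟨i, hi⟩ := hab
    exact ⟨b i, -a i, hi, fun j => by linarith [h i j]⟩
  · push Not at hab
    refine ⟨1, 0, by simp, fun i => ?_⟩
    have := hab i
    simp_all

/-- if `Im(z X Y z*) = 0` for all real skew-symmetric `m × m` matrices
`X, Y` (with `m ≥ 3`), then `Re z` and `Im z` are linearly dependent over `ℝ`. -/
theorem stmt_3 (m : ℕ) (hm : 3 ≤ m) (z : Fin m → ℂ)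
    (h : ∀ X Y : Matrix (Fin m) (Fin m) ℝ, Xᵀ = -X → Yᵀ = -Y →
      (∑ i, ∑ j, z i * (((X * Y) i j : ℝ) : ℂ) * (starRingEnd ℂ) (z j)).im = 0) :
    ∃ c d : ℝ, (c, d) ≠ (0, 0) ∧
      ∀ i, c * (z i).re + d * (z i).im = 0 := by
  refine exists_linear_relation_of_minors_eq_zero fun p q => ?_
  rcases eq_or_ne p q with rfl | hpq
  · exact mul_comm _ _
  obtain ⟨k, hk⟩ : ∃ k, k ∉ ({p, q} : Finset (Fin m)) := by
    refine Finset.exists_mem_notMem_of_card_lt_card (t := Finset.univ) ?_ |>.imp fun _ => And.right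
    simpa [Finset.card_pair hpq, Nat.lt_iff_add_one_le] using hm
  simp only [Finset.mem_insert, Finset.mem_singleton, not_or] at hk
  have key := h (single p k 1 - single k p 1) (single k q 1 - single q k 1)
    (by simp [transpose_sub]) (by simp [transpose_sub])
  rw [single_eq_mul_of_skew hpq (Ne.symm hk.1) (Ne.symm hk.2), Finset.sum_eq_single p,
    Finset.sum_eq_single q] at key
  · simp only [single_apply_same, Complex.ofReal_one, mul_one, Complex.mul_im, Complex.conj_re,
      Complex.conj_im] at key
    linarith
  · intro j _ hj
    simp [hj.symm]
  · simp
  · intro i _ hi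
    simp [hi.symm]
  · simp
end

section
/- Let n1, n2 ≥ 0 be integers and δ ∈ (0, π/2); write c = cos δ, s = sin δ, and set μ = c^{n1−1}·s^{n2−1}·((n1+1)s² − (n2+1)c²). Then the curve γ : ℝ → ℂ² given by γ(t) = (c·exp(i·c^{n1−1}s^{n2+1}·t), s·exp(−i·c^{n1+1}s^{n2−1}·t)) satisfies, for j = 1, 2 and all t ∈ ℝ, γ_j'(t)·conj(γ_j(t)) = (−1)^{j−1}·i·e^{iμt}·conj(γ1(t))^{n1+1}·conj(γ2(t))^{n2+1}. Moreover, μ = 0 if and only if tan²δ = (n2+1)/(n1+1). -/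
/-- For a circular motion `z(t) = r·exp(iωt)`, the product `z'(t)·conj(z(t))` is constant. -/
lemma deriv_mul_conj_circular (r ω t : ℝ) :
    deriv (fun t : ℝ => (r : ℂ) * Complex.exp (Complex.I * (ω : ℂ) * (t : ℂ))) t
      * (starRingEnd ℂ) ((r : ℂ) * Complex.exp (Complex.I * (ω : ℂ) * (t : ℂ)))
      = Complex.I * ω * r ^ 2 := by
  have hexp : HasDerivAt (fun t : ℝ => (r : ℂ) * Complex.exp (Complex.I * (ω : ℂ) * (t : ℂ)))
      ((r : ℂ) * (Complex.exp (Complex.I * ω * t) * (Complex.I * ω * 1))) t :=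
    (((Complex.ofRealCLM.hasDerivAt (x := t)).const_mul (Complex.I * (ω : ℂ))).cexp).const_mul
      (r : ℂ)
  have hinv : Complex.exp (Complex.I * ω * t) * Complex.exp (-Complex.I * ω * t) = 1 := by
    rw [← Complex.exp_add, ← Complex.exp_zero]
    ring_nf
  rw [hexp.deriv]
  simp only [map_mul, ← Complex.exp_conj, Complex.conj_ofReal, Complex.conj_I]
  linear_combination (Complex.I * ω * r ^ 2) * hinv

/-- Powers of the conjugates of two circular motions cancel a phase of the resonant frequency. -/
lemma exp_mul_conj_circular_pow (r₁ r₂ ω₁ ω₂ t : ℝ) (k l : ℕ) :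
    Complex.exp (Complex.I * ((k * ω₁ + l * ω₂ : ℝ) : ℂ) * (t : ℂ))
      * ((starRingEnd ℂ) ((r₁ : ℂ) * Complex.exp (Complex.I * (ω₁ : ℂ) * (t : ℂ)))) ^ k
      * ((starRingEnd ℂ) ((r₂ : ℂ) * Complex.exp (Complex.I * (ω₂ : ℂ) * (t : ℂ)))) ^ l
      = (r₁ : ℂ) ^ k * (r₂ : ℂ) ^ l := by
  simp only [map_mul, ← Complex.exp_conj, Complex.conj_ofReal, Complex.conj_I, mul_pow,
    ← Complex.exp_nat_mul]
  have hexp : Complex.exp (Complex.I * ((k * ω₁ + l * ω₂ : ℝ) : ℂ) * (t : ℂ))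
      * Complex.exp (k * (-Complex.I * ω₁ * t)) * Complex.exp (l * (-Complex.I * ω₂ * t)) = 1 := by
    rw [← Complex.exp_add, ← Complex.exp_add, ← Complex.exp_zero]
    push_cast
    ring_nf
  linear_combination ((r₁ : ℂ) ^ k * (r₂ : ℂ) ^ l) * hexp

lemma rpow_natCast_sub_one_mul_sq {x : ℝ} (hx : 0 < x) (n : ℕ) :
    x ^ ((n : ℝ) - 1) * x ^ 2 = x ^ (n + 1) := by
  rw [← Real.rpow_natCast x 2, ← Real.rpow_natCast x (n + 1), ← Real.rpow_add hx]
  push_cast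
  ring_nf

/-- the explicit Legendre curve
`γ(t) = (c·exp(i·c^{n1−1}s^{n2+1}·t), s·exp(−i·c^{n1+1}s^{n2−1}·t))`, with `c = cos δ`,
`s = sin δ`, solves the contact-minimality ODE with
`μ = c^{n1−1}·s^{n2−1}·((n1+1)s² − (n2+1)c²)`, and `μ = 0` iff
`tan²δ = (n2+1)/(n1+1)`. -/
theorem stmt_5 (n1 n2 : ℕ) (δ : ℝ) (hδ : δ ∈ Set.Ioo 0 (Real.pi / 2))
    (c s μ : ℝ) (hc : c = Real.cos δ) (hs : s = Real.sin δ)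
    (hμ : μ = c ^ ((n1 : ℝ) - 1) * s ^ ((n2 : ℝ) - 1)
      * (((n1 : ℝ) + 1) * s ^ 2 - ((n2 : ℝ) + 1) * c ^ 2))
    (γ1 γ2 : ℝ → ℂ)
    (hγ1 : γ1 = fun t : ℝ =>
      (c : ℂ) * Complex.exp (Complex.I * ((c ^ ((n1 : ℝ) - 1) * s ^ ((n2 : ℝ) + 1) : ℝ) : ℂ) * (t : ℂ)))
    (hγ2 : γ2 = fun t : ℝ =>
      (s : ℂ) * Complex.exp (-(Complex.I * ((c ^ ((n1 : ℝ) + 1) * s ^ ((n2 : ℝ) - 1) : ℝ) : ℂ) * (t : ℂ)))) :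
    (∀ t : ℝ,
      deriv γ1 t * (starRingEnd ℂ) (γ1 t)
        = Complex.I * Complex.exp (Complex.I * (μ : ℂ) * (t : ℂ))
            * ((starRingEnd ℂ) (γ1 t)) ^ (n1 + 1) * ((starRingEnd ℂ) (γ2 t)) ^ (n2 + 1) ∧
      deriv γ2 t * (starRingEnd ℂ) (γ2 t)
        = -(Complex.I * Complex.exp (Complex.I * (μ : ℂ) * (t : ℂ))
            * ((starRingEnd ℂ) (γ1 t)) ^ (n1 + 1) * ((starRingEnd ℂ) (γ2 t)) ^ (n2 + 1))) ∧
    (μ = 0 ↔ Real.tan δ ^ 2 = ((n2 : ℝ) + 1) / ((n1 : ℝ) + 1)) := by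
  have hc0 : 0 < c := hc ▸ Real.cos_pos_of_mem_Ioo ⟨by linarith [hδ.1, Real.pi_pos], hδ.2⟩
  have hs0 : 0 < s := hs ▸ Real.sin_pos_of_pos_of_lt_pi hδ.1 (by linarith [hδ.2, Real.pi_pos])
  have hcp : 0 < c ^ ((n1 : ℝ) - 1) := Real.rpow_pos_of_pos hc0 _
  have hsp : 0 < s ^ ((n2 : ℝ) - 1) := Real.rpow_pos_of_pos hs0 _
  have hc2 := rpow_natCast_sub_one_mul_sq hc0 n1
  have hs2 := rpow_natCast_sub_one_mul_sq hs0 n2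
  have hc1 : c ^ ((n1 : ℝ) + 1) = c ^ (n1 + 1) := by exact_mod_cast Real.rpow_natCast c (n1 + 1)
  have hs1 : s ^ ((n2 : ℝ) + 1) = s ^ (n2 + 1) := by exact_mod_cast Real.rpow_natCast s (n2 + 1)
  rw [hs1] at hγ1
  rw [hc1] at hγ2
  generalize c ^ ((n1 : ℝ) - 1) = p at *
  generalize s ^ ((n2 : ℝ) - 1) = q at *
  have hγ2' : γ2 = fun t : ℝ =>
      (s : ℂ) * Complex.exp (Complex.I * ((-(c ^ (n1 + 1) * q) : ℝ) : ℂ) * (t : ℂ)) := by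
    rw [hγ2]
    funext t
    push_cast
    ring_nf
  have hμ' : μ = (n1 + 1 : ℕ) * (p * s ^ (n2 + 1)) + (n2 + 1 : ℕ) * -(c ^ (n1 + 1) * q) := by
    rw [hμ, ← hc2, ← hs2]
    push_cast
    ring
  refine ⟨fun t => ?_, ?_⟩
  · have hphase := exp_mul_conj_circular_pow c s (p * s ^ (n2 + 1)) (-(c ^ (n1 + 1) * q)) t
      (n1 + 1) (n2 + 1)
    have hd1 := deriv_mul_conj_circular c (p * s ^ (n2 + 1)) t
    have hd2 := deriv_mul_conj_circular s (-(c ^ (n1 + 1) * q)) t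
    have hc2' : (p : ℂ) * (c : ℂ) ^ 2 = (c : ℂ) ^ (n1 + 1) := by exact_mod_cast hc2
    have hs2' : (q : ℂ) * (s : ℂ) ^ 2 = (s : ℂ) ^ (n2 + 1) := by exact_mod_cast hs2
    rw [← hμ'] at hphase
    subst hγ1 hγ2'
    rw [hd1, hd2]
    push_cast at hphase ⊢
    constructor
    · linear_combination (-Complex.I) * hphase + Complex.I * (s : ℂ) ^ (n2 + 1) * hc2'
    · linear_combination Complex.I * hphase - Complex.I * (c : ℂ) ^ (n1 + 1) * hs2'
  · rw [hμ, Real.tan_eq_sin_div_cos, ← hc, ← hs, div_pow,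
      div_eq_div_iff (pow_pos hc0 2).ne' (by positivity), mul_eq_zero,
      or_iff_right (mul_pos hcp hsp).ne', sub_eq_zero, mul_comm (s ^ 2)]
end

section
/- Let n1, n2 ≥ 0 be integers, θ ∈ (0, π/2), and let I ⊆ ℝ be an interval containing 0. Let γ = (γ1, γ2) : I → ℂ² be differentiable with γ(0) = (cos θ, sin θ), with γ1(t) ≠ 0 and γ2(t) ≠ 0 for all t ∈ I, and satisfying for j = 1, 2 and all t ∈ I: γ_j'(t)·conj(γ_j(t)) = (−1)^{j−1}·i·conj(γ1(t))^{n1+1}·conj(γ2(t))^{n2+1}. Then Re(γ1(t)^{n1+1}·γ2(t)^{n2+1}) = cos^{n1+1}θ · sin^{n2+1}θ for all t ∈ I. -/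
open ComplexConjugate

/-- A real function with vanishing derivative within an order-connected set is constant on it. -/
theorem eq_of_hasDerivWithinAt_zero_of_ordConnected {f : ℝ → ℝ} {s : Set ℝ}
    (hs : s.OrdConnected) (hf : ∀ t ∈ s, HasDerivWithinAt f 0 s t)
    {x y : ℝ} (hx : x ∈ s) (hy : y ∈ s) : f y = f x := by
  have h := hs.convex.norm_image_sub_le_of_norm_hasDerivWithin_le (C := 0) hf
    (fun t _ => by simp) hx hy
  rw [zero_mul, norm_le_zero_iff, sub_eq_zero] at h
  exact h

/-- If `z' = i·conj(z)^m·conj(w)^(n+1)` and `w' = -i·conj(z)^(m+1)·conj(w)^n`, then the derivative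
of `z^(m+1)·w^(n+1)` is purely imaginary. -/
theorem re_deriv_pow_mul_pow_eq_zero (m n : ℕ) (z w : ℂ) :
    (((m + 1 : ℕ) : ℂ) * z ^ m * (Complex.I * conj z ^ m * conj w ^ (n + 1)) * w ^ (n + 1)
      + z ^ (m + 1) * (((n + 1 : ℕ) : ℂ) * w ^ n *
        (-(Complex.I * conj z ^ (m + 1) * conj w ^ n)))).re = 0 := by
  have h : ((m + 1 : ℕ) : ℂ) * z ^ m * (Complex.I * conj z ^ m * conj w ^ (n + 1)) * w ^ (n + 1)
      + z ^ (m + 1) * (((n + 1 : ℕ) : ℂ) * w ^ n * (-(Complex.I * conj z ^ (m + 1) * conj w ^ n)))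
      = Complex.I * (((m + 1 : ℕ) * Complex.normSq z ^ m * Complex.normSq w ^ (n + 1)
        - (n + 1 : ℕ) * Complex.normSq z ^ (m + 1) * Complex.normSq w ^ n : ℝ) : ℂ) := by
    push_cast
    simp only [Complex.normSq_eq_conj_mul_self, mul_pow]
    ring
  rw [h, Complex.I_mul_re, Complex.ofReal_im, neg_zero]

/-- along any solution of the ODE
`γ_j'·conj γ_j = (−1)^{j−1}·i·conj(γ1)^{n1+1}·conj(γ2)^{n2+1}` with real initial condition
`γ(0) = (cos θ, sin θ)`, the quantity `Re(γ1^{n1+1}·γ2^{n2+1})` is conserved, equal to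
`cos^{n1+1}θ·sin^{n2+1}θ`. -/
theorem stmt_6 (n1 n2 : ℕ) (θ : ℝ) (hθ : θ ∈ Set.Ioo 0 (Real.pi / 2))
    (I : Set ℝ) (hI : Set.OrdConnected I) (h0 : (0 : ℝ) ∈ I)
    (γ1 γ2 γ1' γ2' : ℝ → ℂ)
    (hd1 : ∀ t ∈ I, HasDerivWithinAt γ1 (γ1' t) I t)
    (hd2 : ∀ t ∈ I, HasDerivWithinAt γ2 (γ2' t) I t)
    (hinit1 : γ1 0 = (Real.cos θ : ℂ)) (hinit2 : γ2 0 = (Real.sin θ : ℂ))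
    (hne1 : ∀ t ∈ I, γ1 t ≠ 0) (hne2 : ∀ t ∈ I, γ2 t ≠ 0)
    (hode1 : ∀ t ∈ I,
      γ1' t * (starRingEnd ℂ) (γ1 t)
        = Complex.I * ((starRingEnd ℂ) (γ1 t)) ^ (n1 + 1) * ((starRingEnd ℂ) (γ2 t)) ^ (n2 + 1))
    (hode2 : ∀ t ∈ I,
      γ2' t * (starRingEnd ℂ) (γ2 t)
        = -(Complex.I * ((starRingEnd ℂ) (γ1 t)) ^ (n1 + 1) * ((starRingEnd ℂ) (γ2 t)) ^ (n2 + 1))) :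
    ∀ t ∈ I, (γ1 t ^ (n1 + 1) * γ2 t ^ (n2 + 1)).re
      = Real.cos θ ^ (n1 + 1) * Real.sin θ ^ (n2 + 1) := by
  have key : ∀ t ∈ I, HasDerivWithinAt
      (fun t => (γ1 t ^ (n1 + 1) * γ2 t ^ (n2 + 1)).re) 0 I t := by
    intro t ht
    have e1 : γ1' t = Complex.I * conj (γ1 t) ^ n1 * conj (γ2 t) ^ (n2 + 1) := by
      apply mul_right_cancel₀ (star_ne_zero.mpr (hne1 t ht))
      exact (hode1 t ht).trans (by rw [← starRingEnd_apply]; ring)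
    have e2 : γ2' t = -(Complex.I * conj (γ1 t) ^ (n1 + 1) * conj (γ2 t) ^ n2) := by
      apply mul_right_cancel₀ (star_ne_zero.mpr (hne2 t ht))
      exact (hode2 t ht).trans (by rw [← starRingEnd_apply]; ring)
    have h := ((hd1 t ht).pow (n1 + 1)).mul ((hd2 t ht).pow (n2 + 1))
    have hre := Complex.reCLM.hasFDerivAt.comp_hasDerivWithinAt t h
    have hzero := re_deriv_pow_mul_pow_eq_zero n1 n2 (γ1 t) (γ2 t)
    rw [← e1, ← e2] at hzero
    exact hre.congr_deriv hzero
  intro t ht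
  rw [eq_of_hasDerivWithinAt_zero_of_ordConnected hI key h0 ht, hinit1, hinit2]
  norm_cast
end

section
/- Let n1, n2 ≥ 0 be integers and let I ⊆ ℝ be an interval symmetric about 0. Suppose γ = (γ1, γ2) : I → ℂ² is differentiable, γ(0) ∈ ℝ², and for j = 1, 2 and all t ∈ I: γ_j'(t)·conj(γ_j(t)) = (−1)^{j−1}·i·conj(γ1(t))^{n1+1}·conj(γ2(t))^{n2+1}. Then the curve δ = (δ1, δ2) : I → ℂ² defined by δ_j(t) = conj(γ_j(−t)) is differentiable, satisfies δ(0) = γ(0), and satisfies the same system: δ_j'(t)·conj(δ_j(t)) = (−1)^{j−1}·i·conj(δ1(t))^{n1+1}·conj(δ2(t))^{n2+1} for all t ∈ I and j = 1, 2. -/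
/-- The reflection `t ↦ conj (f (-t))` of a curve along a symmetric set has derivative
`-conj (f' (-t))`. -/
theorem HasDerivWithinAt.conj_comp_neg {f : ℝ → ℂ} {f' : ℂ} {s : Set ℝ} {t : ℝ}
    (hs : ∀ x ∈ s, -x ∈ s) (hf : HasDerivWithinAt f f' s (-t)) :
    HasDerivWithinAt (fun x => (starRingEnd ℂ) (f (-x))) (-(starRingEnd ℂ) f') s t := by
  have h := (hf.scomp t (hasDerivWithinAt_neg t s) hs).star
  simpa using h

/-- if `γ` solves the ODE
`γ_j'·conj γ_j = (−1)^{j−1}·i·conj(γ1)^{n1+1}·conj(γ2)^{n2+1}` on an interval symmetric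
about `0` with `γ(0) ∈ ℝ²`, then `δ_j(t) = conj(γ_j(−t))` is differentiable, has the same
initial value, and solves the same ODE. -/
theorem stmt_7 (n1 n2 : ℕ) (I : Set ℝ) (hsym : ∀ t ∈ I, -t ∈ I)
    (γ1 γ2 γ1' γ2' : ℝ → ℂ)
    (hd1 : ∀ t ∈ I, HasDerivWithinAt γ1 (γ1' t) I t)
    (hd2 : ∀ t ∈ I, HasDerivWithinAt γ2 (γ2' t) I t)
    (hreal1 : (γ1 0).im = 0) (hreal2 : (γ2 0).im = 0)
    (hode1 : ∀ t ∈ I,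
      γ1' t * (starRingEnd ℂ) (γ1 t)
        = Complex.I * ((starRingEnd ℂ) (γ1 t)) ^ (n1 + 1) * ((starRingEnd ℂ) (γ2 t)) ^ (n2 + 1))
    (hode2 : ∀ t ∈ I,
      γ2' t * (starRingEnd ℂ) (γ2 t)
        = -(Complex.I * ((starRingEnd ℂ) (γ1 t)) ^ (n1 + 1) * ((starRingEnd ℂ) (γ2 t)) ^ (n2 + 1)))
    (δ1 δ2 : ℝ → ℂ)
    (hδ1 : ∀ t, δ1 t = (starRingEnd ℂ) (γ1 (-t)))
    (hδ2 : ∀ t, δ2 t = (starRingEnd ℂ) (γ2 (-t))) :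
    (δ1 0 = γ1 0 ∧ δ2 0 = γ2 0) ∧
    ∃ δ1' δ2' : ℝ → ℂ,
      (∀ t ∈ I, HasDerivWithinAt δ1 (δ1' t) I t) ∧
      (∀ t ∈ I, HasDerivWithinAt δ2 (δ2' t) I t) ∧
      (∀ t ∈ I,
        δ1' t * (starRingEnd ℂ) (δ1 t)
          = Complex.I * ((starRingEnd ℂ) (δ1 t)) ^ (n1 + 1) * ((starRingEnd ℂ) (δ2 t)) ^ (n2 + 1)) ∧
      (∀ t ∈ I,
        δ2' t * (starRingEnd ℂ) (δ2 t)
          = -(Complex.I * ((starRingEnd ℂ) (δ1 t)) ^ (n1 + 1) * ((starRingEnd ℂ) (δ2 t)) ^ (n2 + 1))) := by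
  obtain rfl : δ1 = fun t => (starRingEnd ℂ) (γ1 (-t)) := funext hδ1
  obtain rfl : δ2 = fun t => (starRingEnd ℂ) (γ2 (-t)) := funext hδ2
  refine ⟨⟨?_, ?_⟩, fun t => -(starRingEnd ℂ) (γ1' (-t)), fun t => -(starRingEnd ℂ) (γ2' (-t)),
    fun t ht => (hd1 _ (hsym t ht)).conj_comp_neg hsym,
    fun t ht => (hd2 _ (hsym t ht)).conj_comp_neg hsym, fun t ht => ?_, fun t ht => ?_⟩
  · simpa using Complex.conj_eq_iff_im.2 hreal1
  · simpa using Complex.conj_eq_iff_im.2 hreal2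
  · have h := congrArg (starRingEnd ℂ) (hode1 _ (hsym t ht))
    simp only [map_mul, map_pow, Complex.conj_conj, Complex.conj_I] at h ⊢
    linear_combination -h
  · have h := congrArg (starRingEnd ℂ) (hode2 _ (hsym t ht))
    simp only [map_mul, map_neg, map_pow, Complex.conj_conj, Complex.conj_I] at h ⊢
    linear_combination -h
end

section
/- Let n1, n2 ≥ 0 be integers, n = n1 + n2 + 1, and δ ∈ (0, π/2). For s ∈ ℝ, x ∈ S^{n1} ⊂ ℝ^{n1+1} and y ∈ S^{n2} ⊂ ℝ^{n2+1}, define F(s,x,y) = (cos δ · e^{i s sin²δ} · x, sin δ · e^{−i s cos²δ} · y) ∈ ℂ^{n1+1} × ℂ^{n2+1} = ℂ^{n+1} (where a complex scalar multiplies a real vector componentwise). Then for all (s,x,y) and (ŝ,x̂,ŷ), there exists θ ∈ ℝ with F(ŝ,x̂,ŷ) = e^{iθ}·F(s,x,y) if and only if one of the following four cases holds: (e^{iŝ}, x̂, ŷ) = (e^{is}, x, y), or (e^{iŝ}, x̂, ŷ) = (e^{is}, −x, −y), or (e^{iŝ}, x̂, ŷ) = (−e^{is}, −x, y), or (e^{iŝ},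 x̂, ŷ) = (−e^{is}, x, −y). -/
/-- Two unit real vectors that agree up to unimodular complex scalars agree up to a sign. -/
theorem forall_unimodular_mul_eq_iff {ι : Type*} [Fintype ι] {x xh : EuclideanSpace ℝ ι}
    (hx : ‖x‖ = 1) {A u : ℂ} (hA : ‖A‖ = 1) (hu : ‖u‖ = 1) :
    (∀ k, A * ((xh k : ℝ) : ℂ) = u * ((x k : ℝ) : ℂ)) ↔
      (A = u ∧ xh = x) ∨ (A = -u ∧ xh = -x) := by
  have hu0 : u ≠ 0 := norm_ne_zero_iff.mp (by simp [hu])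
  have hx0 : x ≠ 0 := norm_ne_zero_iff.mp (by simp [hx])
  constructor
  · intro h
    obtain ⟨k, hk⟩ : ∃ k, x k ≠ 0 := by
      by_contra! h0
      exact hx0 (by ext k; simpa using h0 k)
    have hk' : ((x k : ℝ) : ℂ) ≠ 0 := by exact_mod_cast hk
    have habs : |xh k| = |x k| := by
      simpa [hA, hu] using congrArg norm (h k)
    rcases abs_eq_abs.mp habs with e | e
    · have hAu : A = u := mul_right_cancel₀ hk' (by rw [← h k, e])
      refine Or.inl ⟨hAu, ?_⟩
      ext j
      have hj := h j
      rw [hAu] at hj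
      exact_mod_cast mul_left_cancel₀ hu0 hj
    · have hAu : A = -u := by
        apply mul_right_cancel₀ hk'
        have hkk := h k
        rw [e] at hkk
        push_cast at hkk
        linear_combination -hkk
      refine Or.inr ⟨hAu, ?_⟩
      ext j
      have hj : u * ((xh j : ℝ) : ℂ) = u * ((-x j : ℝ) : ℂ) := by
        have hjj := h j
        rw [hAu] at hjj
        push_cast
        linear_combination -hjj
      simpa using (by exact_mod_cast mul_left_cancel₀ hu0 hj : xh j = -x j)
  · rintro (⟨rfl, rfl⟩ | ⟨rfl, rfl⟩) k <;> simp

theorem exists_exp_I_mul_eq {z : ℂ} (hz : ‖z‖ = 1) :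
    ∃ θ : ℝ, Complex.exp (Complex.I * (θ : ℂ)) = z := by
  obtain ⟨θ, h⟩ := Complex.norm_eq_one_iff z |>.mp hz
  exact ⟨θ, by rw [mul_comm, h]⟩


/-- two points
`F(s,x,y) = (cos δ·e^{i s sin²δ}·x, sin δ·e^{−i s cos²δ}·y)` of the Legendrian product
differ by a unit complex scalar `e^{iθ}` exactly when `(e^{is},x,y)` and `(e^{iŝ},x̂,ŷ)`
are related by the `ℤ₂ × ℤ₂` action generated by `h1(e^{is},x,y) = (−e^{is},−x,y)` and
`h2(e^{is},x,y) = (−e^{is},x,−y)`. -/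
theorem stmt_9 (n1 n2 n : ℕ) (hn : n = n1 + n2 + 1)
    (δ : ℝ) (hδ : δ ∈ Set.Ioo 0 (Real.pi / 2))
    (x xh : EuclideanSpace ℝ (Fin (n1 + 1))) (y yh : EuclideanSpace ℝ (Fin (n2 + 1)))
    (hx : ‖x‖ = 1) (hxh : ‖xh‖ = 1) (hy : ‖y‖ = 1) (hyh : ‖yh‖ = 1)
    (s sh : ℝ) :
    (∃ θ : ℝ,
      (∀ k, (Real.cos δ : ℂ) * Complex.exp (Complex.I * (sh : ℂ) * ((Real.sin δ : ℂ)) ^ 2)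
              * ((xh k : ℝ) : ℂ)
          = Complex.exp (Complex.I * (θ : ℂ))
              * ((Real.cos δ : ℂ) * Complex.exp (Complex.I * (s : ℂ) * ((Real.sin δ : ℂ)) ^ 2)
                  * ((x k : ℝ) : ℂ))) ∧
      (∀ k, (Real.sin δ : ℂ) * Complex.exp (-(Complex.I * (sh : ℂ) * ((Real.cos δ : ℂ)) ^ 2))
              * ((yh k : ℝ) : ℂ)
          = Complex.exp (Complex.I * (θ : ℂ))
              * ((Real.sin δ : ℂ) * Complex.exp (-(Complex.I * (s : ℂ) * ((Real.cos δ : ℂ)) ^ 2))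
                  * ((y k : ℝ) : ℂ)))) ↔
    ((Complex.exp (Complex.I * (sh : ℂ)) = Complex.exp (Complex.I * (s : ℂ)) ∧ xh = x ∧ yh = y) ∨
     (Complex.exp (Complex.I * (sh : ℂ)) = Complex.exp (Complex.I * (s : ℂ)) ∧ xh = -x ∧ yh = -y) ∨
     (Complex.exp (Complex.I * (sh : ℂ)) = -Complex.exp (Complex.I * (s : ℂ)) ∧ xh = -x ∧ yh = y) ∨
     (Complex.exp (Complex.I * (sh : ℂ)) = -Complex.exp (Complex.I * (s : ℂ)) ∧ xh = x ∧ yh = -y)) := by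
  have hc : (Real.cos δ : ℂ) ≠ 0 := by
    exact_mod_cast (Real.cos_pos_of_mem_Ioo ⟨by linarith [hδ.1, Real.pi_pos], hδ.2⟩).ne'
  have hs : (Real.sin δ : ℂ) ≠ 0 := by
    exact_mod_cast (Real.sin_pos_of_pos_of_lt_pi hδ.1 (by linarith [hδ.2, Real.pi_pos])).ne'
  have hsplit (r : ℝ) : Complex.exp (Complex.I * (r : ℂ) * (Real.sin δ : ℂ) ^ 2) =
      Complex.exp (Complex.I * (r : ℂ)) *
        Complex.exp (-(Complex.I * (r : ℂ) * (Real.cos δ : ℂ) ^ 2)) := by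
    have h : (Real.sin δ : ℂ) ^ 2 + (Real.cos δ : ℂ) ^ 2 = 1 := by
      exact_mod_cast Real.sin_sq_add_cos_sq δ
    rw [← Complex.exp_add]
    congr 1
    linear_combination (Complex.I * (r : ℂ)) * h
  have hnorm (r : ℝ) : ‖Complex.exp (Complex.I * (r : ℂ))‖ = 1 :=
    Complex.norm_exp_I_mul_ofReal r
  have hnorm' (r : ℝ) :
      ‖Complex.exp (-(Complex.I * (r : ℂ) * (Real.cos δ : ℂ) ^ 2))‖ = 1 := by
    have := hnorm (-(r * Real.cos δ ^ 2))
    push_cast at this ⊢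
    rw [← this]
    congr 2
    ring
  rw [hsplit s, hsplit sh]
  have hE := hnorm sh
  have he := hnorm s
  have hA := hnorm' sh
  have hB := hnorm' s
  generalize Complex.exp (Complex.I * (sh : ℂ)) = E at *
  generalize Complex.exp (Complex.I * (s : ℂ)) = e at *
  generalize Complex.exp (-(Complex.I * (sh : ℂ) * (Real.cos δ : ℂ) ^ 2)) = A at *
  generalize Complex.exp (-(Complex.I * (s : ℂ) * (Real.cos δ : ℂ) ^ 2)) = B at *
  have hA0 : A ≠ 0 := norm_ne_zero_iff.mp (by simp [hA])
  have hB0 : B ≠ 0 := norm_ne_zero_iff.mp (by simp [hB])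
  have key (θ : ℝ) {m : ℕ} {v vh : EuclideanSpace ℝ (Fin m)} (hv : ‖v‖ = 1) {c a b : ℂ}
      (hc : c ≠ 0) (ha : ‖a‖ = 1) (hb : ‖b‖ = 1) :
      (∀ k, c * a * ((vh k : ℝ) : ℂ) =
        Complex.exp (Complex.I * (θ : ℂ)) * (c * b * ((v k : ℝ) : ℂ))) ↔
      (a = Complex.exp (Complex.I * (θ : ℂ)) * b ∧ vh = v) ∨
        (a = -(Complex.exp (Complex.I * (θ : ℂ)) * b) ∧ vh = -v) := by
    rw [← forall_unimodular_mul_eq_iff hv ha (by rw [norm_mul, hnorm, hb, one_mul])]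
    refine forall_congr' fun k => ?_
    rw [mul_assoc, show ∀ t w : ℂ, t * (c * b * w) = c * (t * b * w) by intros; ring,
      mul_right_inj' hc]
  simp only [fun θ => key θ (vh := xh) hx hc (a := E * A) (b := e * B) (by simp [hE, hA])
    (by simp [he, hB]), fun θ => key θ (vh := yh) hy hs hA hB]
  constructor
  · rintro ⟨θ, h1, h2⟩
    rcases h1 with ⟨h1, rfl⟩ | ⟨h1, rfl⟩ <;> rcases h2 with ⟨h2, rfl⟩ | ⟨h2, rfl⟩
    · exact Or.inl ⟨mul_right_cancel₀ hA0 (by linear_combination h1 - e * h2), rfl, rfl⟩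
    · exact Or.inr <| Or.inr <| Or.inr
        ⟨mul_right_cancel₀ hA0 (by linear_combination h1 + e * h2), rfl, rfl⟩
    · exact Or.inr <| Or.inr <| Or.inl
        ⟨mul_right_cancel₀ hA0 (by linear_combination h1 + e * h2), rfl, rfl⟩
    · exact Or.inr <| Or.inl
        ⟨mul_right_cancel₀ hA0 (by linear_combination h1 - e * h2), rfl, rfl⟩
  · obtain ⟨θ, hθ⟩ := exists_exp_I_mul_eq (z := A / B) (by simp [hA, hB])
    obtain ⟨φ, hφ⟩ := exists_exp_I_mul_eq (z := -(A / B)) (by simp [hA, hB])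
    rintro (⟨h, hx', hy'⟩ | ⟨h, hx', hy'⟩ | ⟨h, hx', hy'⟩ | ⟨h, hx', hy'⟩)
    · exact ⟨θ, Or.inl ⟨by rw [hθ, h]; field_simp, hx'⟩, Or.inl ⟨by rw [hθ]; field_simp, hy'⟩⟩
    · exact ⟨φ, Or.inr ⟨by rw [hφ, h]; field_simp, hx'⟩, Or.inr ⟨by rw [hφ]; field_simp, hy'⟩⟩
    · exact ⟨θ, Or.inr ⟨by rw [hθ, h]; field_simp, hx'⟩, Or.inl ⟨by rw [hθ]; field_simp, hy'⟩⟩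
    · exact ⟨φ, Or.inl ⟨by rw [hφ, h]; field_simp, hx'⟩, Or.inr ⟨by rw [hφ]; field_simp, hy'⟩⟩
end

section
/- Let n1, n2 ≥ 0 be integers and ρ > 0; write sh = sinh ρ, ch = cosh ρ, and set μ = sh^{n1−1}·ch^{n2−1}·((n1+1)ch² + (n2+1)sh²). Then the curve α : ℝ → ℂ² given by α(t) = (sh·exp(i·sh^{n1−1}ch^{n2+1}·t), ch·exp(i·sh^{n1+1}ch^{n2−1}·t)) satisfies, for j = 1, 2 and all t ∈ ℝ, α_j'(t)·conj(α_j(t)) = i·e^{iμt}·conj(α1(t))^{n1+1}·conj(α2(t))^{n2+1}. -/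
/-- For uniform circular motion, the velocity times the conjugate position is `i·r²·a`. -/
theorem deriv_mul_conj_circular_motion (r a t : ℝ) :
    deriv (fun t : ℝ => (r : ℂ) * Complex.exp (Complex.I * (a : ℂ) * (t : ℂ))) t
        * (starRingEnd ℂ) ((r : ℂ) * Complex.exp (Complex.I * (a : ℂ) * (t : ℂ)))
      = Complex.I * ((r ^ 2 * a : ℝ) : ℂ) := by
  have hd : HasDerivAt (fun t : ℝ => (r : ℂ) * Complex.exp (Complex.I * (a : ℂ) * (t : ℂ)))
      ((r : ℂ) * (Complex.exp (Complex.I * (a : ℂ) * (t : ℂ)) * (Complex.I * (a : ℂ) * 1))) t :=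
    (((Complex.ofRealCLM.hasDerivAt (x := t)).const_mul (Complex.I * (a : ℂ))).cexp).const_mul _
  have he : Complex.exp (Complex.I * (a : ℂ) * (t : ℂ))
      * Complex.exp (-Complex.I * (a : ℂ) * (t : ℂ)) = 1 := by
    rw [← Complex.exp_add, ← Complex.exp_zero]
    ring_nf
  rw [hd.deriv, map_mul, ← Complex.exp_conj]
  simp only [map_mul, Complex.conj_I, Complex.conj_ofReal]
  push_cast
  linear_combination (Complex.I * (r : ℂ) ^ 2 * (a : ℂ)) * he

/-- Phases of conjugate powers of two circular motions cancel against the matching total phase. -/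
theorem exp_mul_conj_pow_mul_conj_pow (r s a b t : ℝ) (m k : ℕ) :
    Complex.exp (Complex.I * ((m * a + k * b : ℝ) : ℂ) * (t : ℂ))
        * ((starRingEnd ℂ) ((r : ℂ) * Complex.exp (Complex.I * (a : ℂ) * (t : ℂ)))) ^ m
        * ((starRingEnd ℂ) ((s : ℂ) * Complex.exp (Complex.I * (b : ℂ) * (t : ℂ)))) ^ k
      = ((r ^ m * s ^ k : ℝ) : ℂ) := by
  have he : Complex.exp (Complex.I * ((m * a + k * b : ℝ) : ℂ) * (t : ℂ))
      * Complex.exp (-Complex.I * (a : ℂ) * (t : ℂ)) ^ m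
      * Complex.exp (-Complex.I * (b : ℂ) * (t : ℂ)) ^ k = 1 := by
    rw [← Complex.exp_nat_mul, ← Complex.exp_nat_mul, ← Complex.exp_add, ← Complex.exp_add,
      ← Complex.exp_zero]
    push_cast
    ring_nf
  simp only [map_mul, ← Complex.exp_conj, Complex.conj_I, Complex.conj_ofReal, mul_pow]
  push_cast at he ⊢
  linear_combination ((r : ℂ) ^ m * (s : ℂ) ^ k) * he

/-- Multiplying a real power with exponent `n - 1` by the square gives the natural power `n + 1`. -/
theorem sq_mul_rpow_natCast_sub_one {x : ℝ} (hx : 0 < x) (n : ℕ) :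
    x ^ 2 * x ^ ((n : ℝ) - 1) = x ^ (n + 1) := by
  rw [Real.rpow_sub_one hx.ne', Real.rpow_natCast]
  field_simp
  ring

/-- the explicit Legendre curve
`α(t) = (sh·exp(i·sh^{n1−1}ch^{n2+1}·t), ch·exp(i·sh^{n1+1}ch^{n2−1}·t))`, with
`sh = sinh ρ`, `ch = cosh ρ`, solves the anti-de Sitter contact-minimality ODE with
`μ = sh^{n1−1}·ch^{n2−1}·((n1+1)ch² + (n2+1)sh²)`. -/
theorem stmt_13 (n1 n2 : ℕ) (ρ : ℝ) (hρ : 0 < ρ)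
    (sh ch μ : ℝ) (hsh : sh = Real.sinh ρ) (hch : ch = Real.cosh ρ)
    (hμ : μ = sh ^ ((n1 : ℝ) - 1) * ch ^ ((n2 : ℝ) - 1)
      * (((n1 : ℝ) + 1) * ch ^ 2 + ((n2 : ℝ) + 1) * sh ^ 2))
    (α1 α2 : ℝ → ℂ)
    (hα1 : α1 = fun t : ℝ =>
      (sh : ℂ) * Complex.exp (Complex.I * ((sh ^ ((n1 : ℝ) - 1) * ch ^ ((n2 : ℝ) + 1) : ℝ) : ℂ) * (t : ℂ)))
    (hα2 : α2 = fun t : ℝ =>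
      (ch : ℂ) * Complex.exp (Complex.I * ((sh ^ ((n1 : ℝ) + 1) * ch ^ ((n2 : ℝ) - 1) : ℝ) : ℂ) * (t : ℂ))) :
    ∀ t : ℝ,
      deriv α1 t * (starRingEnd ℂ) (α1 t)
        = Complex.I * Complex.exp (Complex.I * (μ : ℂ) * (t : ℂ))
            * ((starRingEnd ℂ) (α1 t)) ^ (n1 + 1) * ((starRingEnd ℂ) (α2 t)) ^ (n2 + 1) ∧
      deriv α2 t * (starRingEnd ℂ) (α2 t)
        = Complex.I * Complex.exp (Complex.I * (μ : ℂ) * (t : ℂ))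
            * ((starRingEnd ℂ) (α1 t)) ^ (n1 + 1) * ((starRingEnd ℂ) (α2 t)) ^ (n2 + 1) := by
  have hs : 0 < sh := hsh ▸ Real.sinh_pos_iff.2 hρ
  have hc : 0 < ch := hch ▸ Real.cosh_pos ρ
  have rpow_succ (x : ℝ) (n : ℕ) : x ^ ((n : ℝ) + 1) = x ^ (n + 1) := by
    exact_mod_cast Real.rpow_natCast x (n + 1)
  have hs' := sq_mul_rpow_natCast_sub_one hs n1
  have hc' := sq_mul_rpow_natCast_sub_one hc n2
  rw [rpow_succ] at hα1 hα2
  have hμ' : μ = ((n1 + 1 : ℕ) : ℝ) * (sh ^ ((n1 : ℝ) - 1) * ch ^ (n2 + 1))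
      + ((n2 + 1 : ℕ) : ℝ) * (sh ^ (n1 + 1) * ch ^ ((n2 : ℝ) - 1)) := by
    rw [hμ, ← hs', ← hc']
    push_cast
    ring
  intro t
  subst hα1 hα2
  rw [deriv_mul_conj_circular_motion, deriv_mul_conj_circular_motion, hμ', mul_assoc Complex.I,
    mul_assoc Complex.I, exp_mul_conj_pow_mul_conj_pow, ← mul_assoc (sh ^ 2), hs',
    mul_left_comm (ch ^ 2), hc']
  exact ⟨rfl, rfl⟩
end

section
/- Let n1, n2 ≥ 0 be integers, ρ > 0, and let I ⊆ ℝ be an interval containing 0. Let α = (α1, α2) : I → ℂ² be differentiable with α(0) = (sinh ρ, cosh ρ), with α1(t) ≠ 0 and α2(t) ≠ 0 for all t ∈ I, and satisfying for j = 1, 2 and all t ∈ I: α_j'(t)·conj(α_j(t)) = i·conj(α1(t))^{n1+1}·conj(α2(t))^{n2+1}. Then Re(α1(t)^{n1+1}·α2(t)^{n2+1}) = sinh^{n1+1}ρ · cosh^{n2+1}ρ for all t ∈ I. -/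
open ComplexConjugate in
/-- If `z' * conj z = i * conj (z ^ (n + 1) * w)` with `z ≠ 0`, then `z ^ n * w * z'` is purely
imaginary. -/
theorem re_mul_eq_zero_of_mul_conj_eq {z z' w : ℂ} {n : ℕ} (hz : z ≠ 0)
    (h : z' * conj z = Complex.I * conj z ^ (n + 1) * conj w) :
    (z ^ n * w * z').re = 0 := by
  have hz' : z' = Complex.I * conj (z ^ n * w) := by
    apply mul_right_cancel₀ ((map_ne_zero (starRingEnd ℂ)).2 hz)
    rw [h, map_mul, map_pow]
    ring
  rw [hz', mul_left_comm, Complex.mul_conj, Complex.I_mul_re, Complex.ofReal_im, neg_zero]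

/-- A function on an order-connected set of reals with vanishing derivative is constant. -/
theorem Set.OrdConnected.eq_of_hasDerivWithinAt_zero {s : Set ℝ} (hs : s.OrdConnected)
    {f : ℝ → ℝ} (hf : ∀ t ∈ s, HasDerivWithinAt f 0 s t) {a b : ℝ} (ha : a ∈ s) (hb : b ∈ s) :
    f a = f b := by
  have h := hs.convex.norm_image_sub_le_of_norm_hasDerivWithin_le (C := 0) hf (by simp) hb ha
  rw [zero_mul, norm_le_zero_iff, sub_eq_zero] at h
  exact h


/-- along any solution of the ODE
`α_j'·conj α_j = i·conj(α1)^{n1+1}·conj(α2)^{n2+1}` with real initial condition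
`α(0) = (sinh ρ, cosh ρ)`, the quantity `Re(α1^{n1+1}·α2^{n2+1})` is conserved, equal to
`sinh^{n1+1}ρ·cosh^{n2+1}ρ`. -/
theorem stmt_14 (n1 n2 : ℕ) (ρ : ℝ) (hρ : 0 < ρ)
    (I : Set ℝ) (hI : Set.OrdConnected I) (h0 : (0 : ℝ) ∈ I)
    (α1 α2 α1' α2' : ℝ → ℂ)
    (hd1 : ∀ t ∈ I, HasDerivWithinAt α1 (α1' t) I t)
    (hd2 : ∀ t ∈ I, HasDerivWithinAt α2 (α2' t) I t)
    (hinit1 : α1 0 = (Real.sinh ρ : ℂ)) (hinit2 : α2 0 = (Real.cosh ρ : ℂ))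
    (hne1 : ∀ t ∈ I, α1 t ≠ 0) (hne2 : ∀ t ∈ I, α2 t ≠ 0)
    (hode1 : ∀ t ∈ I,
      α1' t * (starRingEnd ℂ) (α1 t)
        = Complex.I * ((starRingEnd ℂ) (α1 t)) ^ (n1 + 1) * ((starRingEnd ℂ) (α2 t)) ^ (n2 + 1))
    (hode2 : ∀ t ∈ I,
      α2' t * (starRingEnd ℂ) (α2 t)
        = Complex.I * ((starRingEnd ℂ) (α1 t)) ^ (n1 + 1) * ((starRingEnd ℂ) (α2 t)) ^ (n2 + 1)) :
    ∀ t ∈ I, (α1 t ^ (n1 + 1) * α2 t ^ (n2 + 1)).re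
      = Real.sinh ρ ^ (n1 + 1) * Real.cosh ρ ^ (n2 + 1) := by
  intro t ht
  have hderiv : ∀ s ∈ I,
      HasDerivWithinAt (fun s => (α1 s ^ (n1 + 1) * α2 s ^ (n2 + 1)).re) 0 I s := by
    intro s hs
    have h1 := re_mul_eq_zero_of_mul_conj_eq (w := α2 s ^ (n2 + 1)) (hne1 s hs)
      (by rw [hode1 s hs, map_pow])
    have h2 := re_mul_eq_zero_of_mul_conj_eq (w := α1 s ^ (n1 + 1)) (n := n2) (hne2 s hs)
      (by rw [hode2 s hs, map_pow, mul_right_comm])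
    have hd := Complex.reCLM.hasFDerivAt.comp_hasDerivWithinAt s
      (((hd1 s hs).pow (n1 + 1)).mul ((hd2 s hs).pow (n2 + 1)))
    refine hd.congr_deriv ?_
    have hsplit : ((n1 + 1 : ℕ) : ℂ) * α1 s ^ (n1 + 1 - 1) * α1' s * α2 s ^ (n2 + 1)
        + α1 s ^ (n1 + 1) * (((n2 + 1 : ℕ) : ℂ) * α2 s ^ (n2 + 1 - 1) * α2' s)
        = ((n1 + 1 : ℕ) : ℝ) * (α1 s ^ n1 * α2 s ^ (n2 + 1) * α1' s)
          + ((n2 + 1 : ℕ) : ℝ) * (α2 s ^ n2 * α1 s ^ (n1 + 1) * α2' s) := by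
      simp only [Nat.add_sub_cancel, Complex.ofReal_natCast]
      ring
    simp only [Pi.pow_apply, Complex.reCLM_apply]
    rw [hsplit, Complex.add_re, Complex.re_ofReal_mul, Complex.re_ofReal_mul, h1, h2]
    simp
  rw [hI.eq_of_hasDerivWithinAt_zero hderiv ht h0, hinit1, hinit2]
  norm_cast
end

section
/- Let n1, n2 ≥ 0 be integers, n = n1 + n2 + 1, and ρ > 0. For s ∈ ℝ, x ∈ S^{n1} ⊂ ℝ^{n1+1} and y ∈ RH^{n2} = {y ∈ ℝ^{n2+1} : Σ_{k=1}^{n2} y_k² − y_{n2+1}² = −1, y_{n2+1} > 0}, define F(s,x,y) = (sinh ρ · e^{i s cosh²ρ} · x, cosh ρ · e^{i s sinh²ρ} · y) ∈ ℂ^{n1+1} × ℂ^{n2+1} = ℂ^{n+1} (where a complex scalar multiplies a real vector componentwise). Then for all (s,x,y) and (ŝ,x̂,ŷ), there exists θ ∈ ℝ with F(ŝ,x̂,ŷ) = e^{iθ}·F(s,x,y) if and only if (e^{iŝ}, x̂, ŷ) = (e^{is}, x, y) or (e^{iŝ}, x̂, ŷ) = (−e^{is}, −x, y). -/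
/-- Real tuples that differ by a unit complex scalar are equal or opposite. -/
theorem eq_or_eq_neg_of_unit_complex_smul {ι : Type*} {a b : ι → ℝ} {w : ℂ} (hw : ‖w‖ = 1)
    (ha : ∃ k, a k ≠ 0) (h : ∀ k, (b k : ℂ) = w * (a k : ℂ)) :
    (w = 1 ∧ b = a) ∨ (w = -1 ∧ b = -a) := by
  obtain ⟨k, hk⟩ := ha
  have hwr : w = ((b k / a k : ℝ) : ℂ) := by
    have : (a k : ℂ) ≠ 0 := by exact_mod_cast hk
    push_cast
    rw [h k]
    field_simp
  generalize b k / a k = r at hwr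
  subst hwr
  rw [Complex.norm_real, Real.norm_eq_abs] at hw
  rcases eq_or_eq_neg_of_abs_eq hw with rfl | rfl
  · refine Or.inl ⟨by simp, funext fun j => ?_⟩
    simpa using h j
  · refine Or.inr ⟨by simp, funext fun j => ?_⟩
    have := h j
    simp only [Complex.ofReal_neg, Complex.ofReal_one, neg_one_mul] at this
    exact_mod_cast this

theorem mul_exp_mul_eq_exp_mul_iff {r : ℂ} (hr : r ≠ 0) (A B T p q : ℂ) :
    r * Complex.exp A * p = Complex.exp T * (r * Complex.exp B * q) ↔
      p = Complex.exp (T + B - A) * q := by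
  have hA := Complex.exp_ne_zero A
  rw [Complex.exp_sub, Complex.exp_add, div_mul_eq_mul_div, eq_div_iff hA]
  constructor
  · intro h
    apply mul_left_cancel₀ hr
    linear_combination h
  · intro h
    linear_combination r * h

/-- two points
`F(s,x,y) = (sinh ρ·e^{i s cosh²ρ}·x, cosh ρ·e^{i s sinh²ρ}·y)`, with `x ∈ S^{n1}` and
`y ∈ RH^{n2}` (hyperboloid model), differ by a unit complex scalar `e^{iθ}` exactly when
`(e^{is},x,y)` and `(e^{iŝ},x̂,ŷ)` are equal or related by `h(e^{is},x,y) = (−e^{is},−x,y)`. -/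
theorem stmt_17 (n1 n2 n : ℕ) (hn : n = n1 + n2 + 1) (ρ : ℝ) (hρ : 0 < ρ)
    (x xh : Fin (n1 + 1) → ℝ) (y yh : Fin (n2 + 1) → ℝ)
    (hx : ∑ k, x k ^ 2 = 1) (hxh : ∑ k, xh k ^ 2 = 1)
    (hy : ∑ k : Fin (n2 + 1), (if (k : ℕ) < n2 then y k ^ 2 else -(y k ^ 2)) = -1)
    (hyh : ∑ k : Fin (n2 + 1), (if (k : ℕ) < n2 then yh k ^ 2 else -(yh k ^ 2)) = -1)
    (hylast : 0 < y (Fin.last n2)) (hyhlast : 0 < yh (Fin.last n2))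
    (s s' : ℝ) :
    (∃ θ : ℝ,
      (∀ k, (Real.sinh ρ : ℂ) * Complex.exp (Complex.I * (s' : ℂ) * ((Real.cosh ρ : ℂ)) ^ 2)
              * ((xh k : ℝ) : ℂ)
          = Complex.exp (Complex.I * (θ : ℂ))
              * ((Real.sinh ρ : ℂ) * Complex.exp (Complex.I * (s : ℂ) * ((Real.cosh ρ : ℂ)) ^ 2)
                  * ((x k : ℝ) : ℂ))) ∧
      (∀ k, (Real.cosh ρ : ℂ) * Complex.exp (Complex.I * (s' : ℂ) * ((Real.sinh ρ : ℂ)) ^ 2)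
              * ((yh k : ℝ) : ℂ)
          = Complex.exp (Complex.I * (θ : ℂ))
              * ((Real.cosh ρ : ℂ) * Complex.exp (Complex.I * (s : ℂ) * ((Real.sinh ρ : ℂ)) ^ 2)
                  * ((y k : ℝ) : ℂ)))) ↔
    ((Complex.exp (Complex.I * (s' : ℂ)) = Complex.exp (Complex.I * (s : ℂ)) ∧ xh = x ∧ yh = y) ∨
     (Complex.exp (Complex.I * (s' : ℂ)) = -Complex.exp (Complex.I * (s : ℂ)) ∧ xh = -x ∧ yh = y)) := by
  have hS : (Real.sinh ρ : ℂ) ≠ 0 := by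
    exact_mod_cast (Real.sinh_pos_iff.mpr hρ).ne'
  have hC : (Real.cosh ρ : ℂ) ≠ 0 := by
    exact_mod_cast (Real.cosh_pos ρ).ne'
  have hCS : (Real.cosh ρ : ℂ) ^ 2 = (Real.sinh ρ : ℂ) ^ 2 + 1 := by
    exact_mod_cast Real.cosh_sq ρ
  have hx0 : ∃ k, x k ≠ 0 := by
    by_contra! h
    simp [h] at hx
  have hexp : Complex.exp (Complex.I * s') =
      Complex.exp (Complex.I * s) * (Complex.exp (Complex.I * s - Complex.I * s'))⁻¹ := by
    rw [← Complex.exp_neg, ← Complex.exp_add]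
    congr 1
    ring
  simp only [mul_exp_mul_eq_exp_mul_iff hS, mul_exp_mul_eq_exp_mul_iff hC]
  constructor
  · rintro ⟨θ, h₁, h₂⟩
    have hw₁ : ‖Complex.exp (Complex.I * θ + Complex.I * s * (Real.cosh ρ : ℂ) ^ 2
        - Complex.I * s' * (Real.cosh ρ : ℂ) ^ 2)‖ = 1 := by
      convert Complex.norm_exp_I_mul_ofReal
        (θ + s * Real.cosh ρ ^ 2 - s' * Real.cosh ρ ^ 2) using 3
      push_cast
      ring
    have hw₂ : ‖Complex.exp (Complex.I * θ + Complex.I * s * (Real.sinh ρ : ℂ) ^ 2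
        - Complex.I * s' * (Real.sinh ρ : ℂ) ^ 2)‖ = 1 := by
      convert Complex.norm_exp_I_mul_ofReal
        (θ + s * Real.sinh ρ ^ 2 - s' * Real.sinh ρ ^ 2) using 3
      push_cast
      ring
    obtain ⟨e₂, rfl⟩ | ⟨-, hneg⟩ :=
      eq_or_eq_neg_of_unit_complex_smul hw₂ ⟨_, hylast.ne'⟩ h₂
    · have hd : Complex.exp (Complex.I * θ + Complex.I * s * (Real.cosh ρ : ℂ) ^ 2
          - Complex.I * s' * (Real.cosh ρ : ℂ) ^ 2)
          = Complex.exp (Complex.I * s - Complex.I * s') := by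
        rw [← one_mul (Complex.exp (Complex.I * s - Complex.I * s')), ← e₂,
          ← Complex.exp_add, hCS]
        congr 1
        ring
      rw [hexp, ← hd]
      obtain ⟨e₁, hxx⟩ | ⟨e₁, hxx⟩ := eq_or_eq_neg_of_unit_complex_smul hw₁ hx0 h₁
      · exact Or.inl ⟨by rw [e₁]; simp, hxx, rfl⟩
      · exact Or.inr ⟨by rw [e₁, inv_neg]; simp, hxx, rfl⟩
    · have := congrFun hneg (Fin.last n2)
      rw [Pi.neg_apply] at this
      linarith
  · intro h
    refine ⟨(s' - s) * Real.sinh ρ ^ 2, ?_⟩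
    have e₁ : Complex.I * (((s' - s) * Real.sinh ρ ^ 2 : ℝ) : ℂ)
        + Complex.I * s * (Real.cosh ρ : ℂ) ^ 2
        - Complex.I * s' * (Real.cosh ρ : ℂ) ^ 2 = Complex.I * s - Complex.I * s' := by
      rw [hCS]
      push_cast
      ring
    have e₂ : Complex.I * (((s' - s) * Real.sinh ρ ^ 2 : ℝ) : ℂ)
        + Complex.I * s * (Real.sinh ρ : ℂ) ^ 2
        - Complex.I * s' * (Real.sinh ρ : ℂ) ^ 2 = 0 := by
      push_cast
      ring
    rw [e₁, e₂, Complex.exp_sub]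
    rcases h with ⟨h, rfl, rfl⟩ | ⟨h, rfl, rfl⟩
    · simp [h]
    · simp [h]
end
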